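/- Let u₁,…,u_m be unitary operators on a Hilbert space H and δ > 0 such that for every nonzero ξ ∈ H there exist indices i,j with ‖u_iξ − u_jξ‖ ≥ δ‖ξ‖. Then ‖Σ_{i=1}^m u_i‖ ≤ sqrt(m² − δ²/2). -/

import Mathlib

theorem aux_identity {H : Type*} [NormedAddCommGroup H] [InnerProductSpace ℂ H]
    (m : ℕ) (v : Fin m → H) (r : ℝ) (hv : ∀ i, ‖v i‖ = r) :
    ∑ i, ∑ j, ‖v i - v j‖ ^ 2 = 2 * (m : ℝ) ^ 2 * r ^ 2 - 2 * ‖∑ i, v i‖ ^ 2 := by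
  have h1 : ‖∑ i, v i‖ ^ 2 = ∑ i, ∑ j, RCLike.re (inner ℂ (v i) (v j)) := by
    rw [← inner_self_eq_norm_sq (𝕜 := ℂ), sum_inner, map_sum]
    refine Finset.sum_congr rfl fun i _ => ?_
    rw [inner_sum, map_sum]
  have h2 : ∀ i j, ‖v i - v j‖ ^ 2 = 2 * r ^ 2 - 2 * RCLike.re (inner ℂ (v i) (v j)) := by
    intro i j
    rw [norm_sub_sq (𝕜 := ℂ), hv, hv]
    ring
  simp_rw [h2, Finset.sum_sub_distrib, ← Finset.mul_sum]
  rw [h1]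
  simp
  ring

/-- If `u₁,…,u_m` are unitaries on a Hilbert space and `δ > 0` is such that every nonzero
`ξ` admits `i, j` with `‖u_iξ − u_jξ‖ ≥ δ‖ξ‖`, then `‖Σ u_i‖ ≤ √(m² − δ²/2)`. -/
theorem stmt5 {H : Type*} [NormedAddCommGroup H] [InnerProductSpace ℂ H] [CompleteSpace H]
    (m : ℕ) (u : Fin m → H →L[ℂ] H)
    (hu : ∀ i, u i ∈ unitary (H →L[ℂ] H))
    (δ : ℝ) (hδ : 0 < δ)
    (hyp : ∀ ξ : H, ξ ≠ 0 → ∃ i j, δ * ‖ξ‖ ≤ ‖u i ξ - u j ξ‖) :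
    ‖∑ i, u i‖ ≤ Real.sqrt ((m : ℝ) ^ 2 - δ ^ 2 / 2) := by
  refine ContinuousLinearMap.opNorm_le_bound _ (Real.sqrt_nonneg _) fun ξ => ?_
  by_cases hξ : ξ = 0
  · simp [hξ]
  obtain ⟨i, j, hij⟩ := hyp ξ hξ
  have hn : ∀ i, ‖u i ξ‖ = ‖ξ‖ := fun i =>
    ContinuousLinearMap.norm_map_of_mem_unitary (hu i) ξ
  have hid := aux_identity m (fun i => u i ξ) ‖ξ‖ hn
  have h1 : ‖u i ξ - u j ξ‖ ^ 2 ≤ ∑ i, ∑ j, ‖u i ξ - u j ξ‖ ^ 2 :=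
    (Finset.single_le_sum (f := fun j => ‖u i ξ - u j ξ‖ ^ 2)
      (fun _ _ => by positivity) (Finset.mem_univ j)).trans
    (Finset.single_le_sum (f := fun i => ∑ j, ‖u i ξ - u j ξ‖ ^ 2)
      (fun _ _ => by positivity) (Finset.mem_univ i))
  have h2 : (δ * ‖ξ‖) ^ 2 ≤ ‖u i ξ - u j ξ‖ ^ 2 :=
    pow_le_pow_left₀ (by positivity) hij 2
  have h3 : ‖(∑ i, u i) ξ‖ ^ 2 ≤ ((m : ℝ) ^ 2 - δ ^ 2 / 2) * ‖ξ‖ ^ 2 := by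
    rw [sum_apply]
    nlinarith
  have h4 := Real.le_sqrt_of_sq_le h3
  rwa [Real.sqrt_mul' _ (by positivity), Real.sqrt_sq (norm_nonneg _)] at h4
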